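/- Let k be a field of characteristic zero and n ≥ 1. In O(M_n), the determinant Det is Poisson central: {Det, f} = 0 for every f ∈ O(M_n). -/

import Mathlib

noncomputable section

open MvPolynomial

/-- A Poisson bracket on a commutative `k`-algebra `R`: a `k`-bilinear antisymmetric map
satisfying the Jacobi identity and the Leibniz rule in each argument. -/
structure PoissonBracket (k R : Type*) [CommRing k] [CommRing R] [Algebra k R] where
  bracket : R →ₗ[k] R →ₗ[k] R
  antisymm : ∀ a b : R, bracket a b = - bracket b a
  jacobi : ∀ a b c : R,
    bracket a (bracket b c) + bracket b (bracket c a) + bracket c (bracket a b) = 0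
  leibniz : ∀ a b c : R, bracket a (b * c) = bracket a b * c + b * bracket a c

namespace Derivation

variable {R A : Type*} [CommRing R] [CommRing A] [Algebra R A] (D : Derivation R A A)

theorem leibniz_finset_prod {ι : Type*} [DecidableEq ι] (s : Finset ι) (f : ι → A) :
    D (∏ i ∈ s, f i) = ∑ i ∈ s, (∏ j ∈ s.erase i, f j) * D (f i) := by
  induction s using Finset.induction_on with
  | empty => simp
  | insert a s ha ih =>
    rw [Finset.prod_insert ha, D.leibniz, ih, Finset.sum_insert ha, Finset.erase_insert ha,
      smul_eq_mul, smul_eq_mul, Finset.mul_sum, add_comm]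
    congr 1
    refine Finset.sum_congr rfl fun i hi => ?_
    have hai : a ≠ i := fun h => ha (h ▸ hi)
    rw [Finset.erase_insert_of_ne hai, Finset.prod_insert (by simp [ha]), mul_assoc]

variable {n : Type*} [Fintype n] [DecidableEq n]

/-- Jacobi's formula for a derivation. -/
theorem apply_det (M : Matrix n n A) :
    D M.det = ∑ j, ∑ i, M.adjugate j i * D (M i j) := by
  have h (j : n) : ∑ i, M.adjugate j i * D (M i j) = (M.updateCol j fun i => D (M i j)).det := by
    rw [← Matrix.cramer_apply, Matrix.cramer_eq_adjugate_mulVec]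
    rfl
  simp_rw [h, Matrix.det_apply]
  rw [Finset.sum_comm, map_sum]
  refine Finset.sum_congr rfl fun σ _ => ?_
  rw [← Finset.smul_sum, Units.smul_def, Units.smul_def, map_zsmul, leibniz_finset_prod]
  congr 1
  refine Finset.sum_congr rfl fun j _ => ?_
  rw [← Finset.prod_erase_mul _ _ (Finset.mem_univ j), Matrix.updateCol_self]
  congr 1
  refine Finset.prod_congr rfl fun i hi => ?_
  rw [Matrix.updateCol_ne (Finset.ne_of_mem_erase hi)]

theorem apply_det_eq_zero (M : Matrix n n A) (l m : n) (r c : n → A) (hr : r l = 0) (hc : c m = 0)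
    (h : ∀ i j, D (M i j) = (r i + c j) * (M i m * M l j)) : D M.det = 0 := by
  have hrow (i : n) : ∑ j, M l j * M.adjugate j i = if l = i then M.det else 0 := by
    simpa [Matrix.mul_apply, Matrix.one_apply] using congr_fun₂ M.mul_adjugate l i
  have hcol (j : n) : ∑ i, M.adjugate j i * M i m = if j = m then M.det else 0 := by
    simpa [Matrix.mul_apply, Matrix.one_apply] using congr_fun₂ M.adjugate_mul j m
  calc D M.det
      = ∑ j, ∑ i, (r i * M i m * (M l j * M.adjugate j i)
          + c j * M l j * (M.adjugate j i * M i m)) := by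
        rw [apply_det]
        refine Finset.sum_congr rfl fun j _ => Finset.sum_congr rfl fun i _ => ?_
        rw [h]
        ring
    _ = ∑ i, r i * M i m * ∑ j, M l j * M.adjugate j i
          + ∑ j, c j * M l j * ∑ i, M.adjugate j i * M i m := by
        simp_rw [Finset.sum_add_distrib, Finset.mul_sum]
        rw [Finset.sum_comm]
    _ = 0 := by simp [hrow, hcol, hr, hc]

end Derivation

namespace PoissonBracket

variable {k R : Type*} [CommRing k] [CommRing R] [Algebra k R] (P : PoissonBracket k R)

/-- The Hamiltonian derivation `{a, ·}`. -/
def hamiltonian (a : R) : Derivation k R R :=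
  Derivation.mk' (P.bracket a) fun b c => by
    rw [P.leibniz, smul_eq_mul, smul_eq_mul]
    ring

theorem hamiltonian_apply (a b : R) : P.hamiltonian a b = P.bracket a b := rfl

theorem bracket_self [IsDomain R] [CharZero R] (a : R) : P.bracket a a = 0 :=
  self_eq_neg.mp (P.antisymm a a)

end PoissonBracket

/-- Let `k` be a field of characteristic zero and `n ≥ 1`.  In
`O(M_n)` (the polynomial ring on the variables `x_{ij}`, `1 ≤ i,j ≤ n`, with the standard
Poisson bracket given on generators below), the determinant `Det` of the generic matrix
`(x_{ij})` is Poisson central: `{Det, f} = 0` for every `f ∈ O(M_n)`. -/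
theorem statement10
    (k : Type*) [Field k] [CharZero k] (n : ℕ) (hn : 1 ≤ n)
    (P : PoissonBracket k (MvPolynomial (Fin n × Fin n) k))
    (hProw : ∀ i j m : Fin n, j < m →
      P.bracket (X (i, j)) (X (i, m)) = X (i, j) * X (i, m))
    (hPcol : ∀ i l j : Fin n, i < l →
      P.bracket (X (i, j)) (X (l, j)) = X (i, j) * X (l, j))
    (hPanti : ∀ i l j m : Fin n, i < l → j < m →
      P.bracket (X (i, m)) (X (l, j)) = 0)
    (hPdiag : ∀ i l j m : Fin n, i < l → j < m →
      P.bracket (X (i, j)) (X (l, m)) = 2 * (X (i, m) * X (l, j))) :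
    ∀ f : MvPolynomial (Fin n × Fin n) k,
      P.bracket ((Matrix.of fun i j : Fin n =>
        (X (i, j) : MvPolynomial (Fin n × Fin n) k)).det) f = 0 := by
  have hgen (l m i j : Fin n) : P.bracket (X (l, m)) (X (i, j)) =
      (((SignType.sign ((i : ℤ) - l) : ℤ) : MvPolynomial (Fin n × Fin n) k)
        + ((SignType.sign ((j : ℤ) - m) : ℤ) : MvPolynomial (Fin n × Fin n) k))
        * (X (i, m) * X (l, j)) := by
    have hpos {a b : Fin n} (h : a < b) : SignType.sign ((b : ℤ) - a) = 1 :=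
      sign_pos (by have : (a : ℕ) < b := h; omega)
    have hneg {a b : Fin n} (h : a < b) : SignType.sign ((a : ℤ) - b) = -1 :=
      sign_neg (by have : (a : ℕ) < b := h; omega)
    rcases lt_trichotomy l i with hi | rfl | hi <;> rcases lt_trichotomy m j with hj | rfl | hj
    · rw [hPdiag _ _ _ _ hi hj, hpos hi, hpos hj]
      simp only [SignType.coe_one]
      push_cast
      ring
    · rw [hPcol _ _ _ hi, hpos hi]
      simp [mul_comm]
    · rw [hPanti _ _ _ _ hi hj, hpos hi, hneg hj]
      simp
    · rw [hProw _ _ _ hj, hpos hj]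
      simp
    · simp [P.bracket_self]
    · rw [P.antisymm, hProw _ _ _ hj, hneg hj]
      simp [mul_comm]
    · rw [P.antisymm, hPanti _ _ _ _ hi hj, hneg hi, hpos hj]
      simp
    · rw [P.antisymm, hPcol _ _ _ hi, hneg hi]
      simp
    · rw [P.antisymm, hPdiag _ _ _ _ hi hj, hneg hi, hneg hj]
      simp only [SignType.coe_neg_one]
      push_cast
      ring
  intro f
  rw [← P.hamiltonian_apply]
  refine derivation_eq_zero_of_forall_mem_vars fun ⟨l, m⟩ _ => ?_
  rw [P.hamiltonian_apply, P.antisymm, neg_eq_zero, ← P.hamiltonian_apply]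
  exact Derivation.apply_det_eq_zero _ _ l m
    (fun i => ((SignType.sign ((i : ℤ) - l) : ℤ) : MvPolynomial (Fin n × Fin n) k))
    (fun j => ((SignType.sign ((j : ℤ) - m) : ℤ) : MvPolynomial (Fin n × Fin n) k))
    (by simp) (by simp) fun i j => hgen l m i j
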